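/- arXiv:2407.17068 — 2 statements merged into one kernel-verified Lean document; each statement's English description precedes it below -/
import Mathlib

section
/- Let F be a symmetric probability measure on S^{N-1}(√N) with N ≥ 2, and e_i := v_i². Then for every label sequence J of length n ≤ N/2 + 1, with len(J) the number of distinct labels in J, the joint cumulant satisfies |κ[e_J]| ≤ 4^{n-1} (n-1)! N^{n - len(J)}. -/
open MeasureTheory Finset

/-- The joint cumulant `κ[e_{J_1}, …, e_{J_n}]` of the energies `e_i = v_i²`, defined as the
`n`-th iterated derivative at `0` of the cumulant generating function
`ξ ↦ log E[exp(∑_i ξ_i v_i²)]`, evaluated in the coordinate directions `J_1, …, J_n`. -/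
noncomputable def jointEnergyCumulant {N : ℕ} (F : Measure (Fin N → ℝ)) {n : ℕ}
    (J : Fin n → Fin N) : ℝ :=
  iteratedFDeriv ℝ n
    (fun ξ : Fin N → ℝ => Real.log (∫ v, Real.exp (∑ i, ξ i * (v i) ^ 2) ∂F)) 0
    (fun k => Pi.single (J k) 1)

namespace SymCum

/-- Iterated directional derivatives along coordinate directions. -/
noncomputable def D {N : ℕ} : List (Fin N) → ((Fin N → ℝ) → ℝ) → (Fin N → ℝ) → ℝ
  | [], f => f
  | a :: l, f => fun x => fderiv ℝ (D l f) x (Pi.single a 1)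

/-- All ways to split a list into two complementary sublists. -/
def splits {α : Type} : List α → List (List α × List α)
  | [] => [([], [])]
  | a :: l => (splits l).map (fun q => (q.1, a :: q.2)) ++ (splits l).map (fun q => (a :: q.1, q.2))

lemma splits_head {α : Type} (l : List α) :
    ∃ rest, splits l = ([], l) :: rest ∧ ∀ q ∈ rest, q.1 ≠ [] := by
  induction l with
  | nil => exact ⟨[], rfl, by simp⟩
  | cons a l ih =>
    obtain ⟨r, hr, h⟩ := ih
    refine ⟨r.map (fun q => (q.1, a :: q.2)) ++ (splits l).map (fun q => (a :: q.1, q.2)), ?_, ?_⟩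
    · simp [splits, hr]
    · intro q hq
      simp only [List.mem_append, List.mem_map] at hq
      rcases hq with ⟨q', h1, rfl⟩ | ⟨q', h1, rfl⟩
      · exact h q' h1
      · simp

lemma splits_mem {α : Type} [DecidableEq α] (l : List α) :
    ∀ q ∈ splits l, q.1.length + q.2.length = l.length ∧
      q.1.toFinset ∪ q.2.toFinset = l.toFinset := by
  induction l with
  | nil => intro q hq; simp [splits] at hq; subst hq; simp
  | cons a l ih =>
    intro q hq
    simp only [splits, List.mem_append, List.mem_map] at hq
    rcases hq with ⟨q', h1, rfl⟩ | ⟨q', h1, rfl⟩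
    · obtain ⟨h2, h3⟩ := ih q' h1
      refine ⟨by simp only [List.length_cons]; omega, ?_⟩
      simp [← h3]
    · obtain ⟨h2, h3⟩ := ih q' h1
      refine ⟨by simp only [List.length_cons]; omega, ?_⟩
      simp [← h3]

lemma splits_sum {α : Type} (l : List α) : ∀ φ : ℕ → ℝ,
    ((splits l).map (fun q => φ q.2.length)).sum =
      ∑ ij ∈ Finset.HasAntidiagonal.antidiagonal l.length, (l.length.choose ij.1 : ℝ) * φ ij.2 := by
  induction l with
  | nil => intro φ; simp [splits]
  | cons a l ih =>
    intro φ
    rw [List.length_cons, Finset.sum_antidiagonal_choose_succ_mul (fun _ j => φ j)]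
    simp only [splits, List.map_append, List.map_map, List.sum_append]
    have h1 := ih (fun t => φ (t + 1))
    have h2 := ih φ
    simp only [Function.comp_def, List.length_cons]
    rw [h1, h2]
    congr 1
    apply Finset.sum_congr rfl
    intro ij hij
    rw [Finset.HasAntidiagonal.mem_antidiagonal] at hij
    rw [← hij, Nat.choose_symm_add]

lemma A_bound (p : ℕ) :
    ∑ ij ∈ Finset.HasAntidiagonal.antidiagonal p, (p.choose ij.1 : ℝ) * (2 ^ ij.2 * (ij.2.factorial : ℝ))
      ≤ 2 * (2 ^ p * (p.factorial : ℝ)) - 1 := by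
  induction p with
  | zero => norm_num
  | succ p ih =>
    rw [Finset.Nat.sum_antidiagonal_succ']
    have h : ∀ ij ∈ Finset.HasAntidiagonal.antidiagonal p,
        ((p+1).choose ij.1 : ℝ) * (2 ^ (ij.2+1) * ((ij.2+1).factorial : ℝ)) =
        2 * (p + 1) * ((p.choose ij.1 : ℝ) * (2 ^ ij.2 * (ij.2.factorial : ℝ))) := by
      intro ij hij
      rw [Finset.HasAntidiagonal.mem_antidiagonal] at hij
      have h1 := Nat.add_one_mul_choose_eq p ij.2
      have h2 : p.choose ij.1 = p.choose ij.2 := by rw [← hij, Nat.choose_symm_add]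
      have h3 : (p+1).choose ij.1 = (p+1).choose (ij.2+1) := by
        rw [← hij, add_assoc, Nat.choose_symm_add]
      rw [h2, h3, Nat.factorial_succ]
      have h4 : ((p:ℝ)+1) * (p.choose ij.2 : ℝ) = ((p+1).choose (ij.2+1) : ℝ) * (ij.2 + 1) := by
        exact_mod_cast h1
      push_cast
      linear_combination (-2 * 2 ^ ij.2 * (ij.2.factorial : ℝ)) * h4
    simp only []
    rw [Finset.sum_congr rfl h, ← Finset.mul_sum]
    simp only [Nat.choose_self, Nat.factorial_succ]
    have h5 := mul_le_mul_of_nonneg_left ih (by positivity : (0:ℝ) ≤ 2 * (p+1))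
    push_cast
    rw [pow_succ]
    have : (0:ℝ) ≤ p := by positivity
    norm_num
    nlinarith

open scoped ContDiff

lemma D_contDiff {N : ℕ} (l : List (Fin N)) {f : (Fin N → ℝ) → ℝ} (hf : ContDiff ℝ ∞ f) :
    ContDiff ℝ ∞ (D l f) := by
  induction l with
  | nil => exact hf
  | cons a l ih => exact (contDiff_infty_iff_fderiv.1 ih).2.clm_apply contDiff_const

lemma D_snoc {N : ℕ} (l : List (Fin N)) (a : Fin N) (f : (Fin N → ℝ) → ℝ) :
    D (l ++ [a]) f = D l (D [a] f) := by
  induction l with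
  | nil => rfl
  | cons b l ih =>
    funext x
    change fderiv ℝ (D (l ++ [a]) f) x _ = fderiv ℝ (D l (D [a] f)) x _
    rw [ih]

lemma D_iter {N : ℕ} {f : (Fin N → ℝ) → ℝ} (hf : ContDiff ℝ ∞ f) (n : ℕ) :
    ∀ (J : Fin n → Fin N) (x : Fin N → ℝ),
      iteratedFDeriv ℝ n f x (fun k => Pi.single (J k) 1) = D (List.ofFn J) f x := by
  induction n with
  | zero => intro J x; simp [D]
  | succ n ih =>
    intro J x
    rw [iteratedFDeriv_succ_apply_left, List.ofFn_succ, D]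
    have h : D (List.ofFn fun i => J i.succ) f =
        fun y => iteratedFDeriv ℝ n f y (fun k => Pi.single (J k.succ) 1) := by
      funext y; rw [ih]
    rw [h]
    have hd : DifferentiableAt ℝ (iteratedFDeriv ℝ n f) x :=
      (hf.differentiable_iteratedFDeriv (by exact_mod_cast WithTop.coe_lt_top n)) x
    beta_reduce
    rw [fderiv_continuousMultilinear_apply_const_apply hd]
    rfl

lemma D_add_sum {N : ℕ} (L : List (List (Fin N) × List (Fin N)))
    {f g : (Fin N → ℝ) → ℝ} (hf : ContDiff ℝ ∞ f) (hg : ContDiff ℝ ∞ g) (x : Fin N → ℝ) :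
    HasFDerivAt (fun y => (L.map (fun q => D q.1 f y * D q.2 g y)).sum)
      ((L.map (fun q => D q.1 f x • fderiv ℝ (D q.2 g) x + D q.2 g x • fderiv ℝ (D q.1 f) x)).sum) x := by
  induction L with
  | nil => simpa using hasFDerivAt_const (0:ℝ) x
  | cons q L ih =>
    simp only [List.map_cons, List.sum_cons]
    have h1 := ((D_contDiff q.1 hf).differentiable (by simp) x).hasFDerivAt
    have h2 := ((D_contDiff q.2 hg).differentiable (by simp) x).hasFDerivAt
    exact (h1.mul h2).add ih

lemma D_mul {N : ℕ} (l : List (Fin N)) {f g : (Fin N → ℝ) → ℝ}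
    (hf : ContDiff ℝ ∞ f) (hg : ContDiff ℝ ∞ g) :
    D l (fun x => f x * g x) = fun x =>
      ((splits l).map (fun q => D q.1 f x * D q.2 g x)).sum := by
  induction l with
  | nil => funext x; simp [D, splits]
  | cons a l ih =>
    funext x
    rw [D, ih]
    beta_reduce
    rw [(D_add_sum (splits l) hf hg x).fderiv]
    simp only [splits, List.map_append, List.map_map, List.sum_append, Function.comp_def, D]
    induction splits l with
    | nil => simp
    | cons q L ih2 =>
      simp only [List.map_cons, List.sum_cons, _root_.add_apply, ih2,
        _root_.smul_apply, smul_eq_mul]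
      ring

section measure

variable {N : ℕ} (F : Measure (Fin N → ℝ))

/-- The moment integrand. -/
noncomputable def G (l : List (Fin N)) (ξ v : Fin N → ℝ) : ℝ :=
  (l.map (fun i => v i ^ 2)).prod * Real.exp (∑ i, ξ i * (v i) ^ 2)

/-- The tilted moment. -/
noncomputable def Mo (l : List (Fin N)) (ξ : Fin N → ℝ) : ℝ := ∫ v, G l ξ v ∂F

lemma G_cont (l : List (Fin N)) (ξ : Fin N → ℝ) : Continuous (G l ξ) := by
  unfold G
  have h : Continuous fun v : Fin N → ℝ => (l.map (fun i => v i ^ 2)).prod := by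
    induction l with
    | nil => simpa using continuous_const
    | cons a l ih => simp only [List.map_cons, List.prod_cons]; fun_prop
  fun_prop

lemma G_nonneg (l : List (Fin N)) (ξ v : Fin N → ℝ) : 0 ≤ G l ξ v := by
  unfold G
  have : 0 ≤ (l.map (fun i => v i ^ 2)).prod := by
    apply List.prod_nonneg
    intro a ha
    obtain ⟨i, _, rfl⟩ := List.mem_map.1 ha
    positivity
  positivity

lemma e_le (v : Fin N → ℝ) (hv : ∑ i, (v i) ^ 2 = (N : ℝ)) (i : Fin N) : v i ^ 2 ≤ N := by
  rw [← hv]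
  exact Finset.single_le_sum (f := fun i => v i ^ 2) (fun _ _ => sq_nonneg _) (Finset.mem_univ i)

lemma G_le (l : List (Fin N)) (ξ v : Fin N → ℝ) (hv : ∑ i, (v i) ^ 2 = (N : ℝ)) :
    G l ξ v ≤ (N:ℝ) ^ l.length * Real.exp (‖ξ‖ * N) := by
  unfold G
  have h1 : (l.map (fun i => v i ^ 2)).prod ≤ (N:ℝ) ^ l.length := by
    induction l with
    | nil => simp
    | cons a l ih =>
      simp only [List.map_cons, List.prod_cons, List.length_cons, pow_succ' (N:ℝ)]
      have h0 : 0 ≤ (l.map (fun i => v i ^ 2)).prod := by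
        simpa [G] using G_nonneg l 0 v
      exact mul_le_mul (e_le v hv a) ih h0 (by positivity)
  have h2 : ∑ i, ξ i * (v i) ^ 2 ≤ ‖ξ‖ * N := by
    rw [← hv, Finset.mul_sum]
    apply Finset.sum_le_sum
    intro i _
    apply mul_le_mul_of_nonneg_right _ (sq_nonneg _)
    exact (Real.le_norm_self _).trans (norm_le_pi_norm ξ i)
  gcongr

variable [IsProbabilityMeasure F]

lemma G_int (hsphere : ∀ᵐ v ∂F, ∑ i, (v i) ^ 2 = (N : ℝ)) (l : List (Fin N)) (ξ : Fin N → ℝ) : Integrable (G l ξ) F := by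
  refine Integrable.of_bound (G_cont l ξ).aestronglyMeasurable
    ((N:ℝ) ^ l.length * Real.exp (‖ξ‖ * N)) ?_
  filter_upwards [hsphere] with v hv
  rw [Real.norm_of_nonneg (G_nonneg _ _ _)]
  exact G_le l ξ v hv

lemma Mo_deriv (hsphere : ∀ᵐ v ∂F, ∑ i, (v i) ^ 2 = (N : ℝ)) (l : List (Fin N)) (ξ : Fin N → ℝ) :
    HasFDerivAt (Mo F l)
      (∑ i, Mo F (i :: l) ξ • (ContinuousLinearMap.proj i : (Fin N → ℝ) →L[ℝ] ℝ)) ξ := by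
  have key := hasFDerivAt_integral_of_dominated_of_fderiv_le (𝕜 := ℝ) (μ := F) (F := fun ξ v => G l ξ v)
    (F' := fun ξ v => ∑ i, G (i :: l) ξ v • (ContinuousLinearMap.proj i : (Fin N → ℝ) →L[ℝ] ℝ))
    (x₀ := ξ) (s := Metric.ball ξ 1)
    (bound := fun _ => ∑ i : Fin N, ((N:ℝ) ^ (l.length + 1) * Real.exp ((‖ξ‖ + 1) * N)) *
      ‖(ContinuousLinearMap.proj i : (Fin N → ℝ) →L[ℝ] ℝ)‖)
    (Metric.ball_mem_nhds ξ one_pos)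
    (Filter.Eventually.of_forall fun x => (G_cont l x).aestronglyMeasurable)
    (G_int F hsphere l ξ)
    (by
      apply Continuous.aestronglyMeasurable
      apply continuous_finsetSum
      intro i _
      exact (G_cont (i :: l) ξ).smul continuous_const)
    (by
      filter_upwards [hsphere] with v hv x hx
      refine (norm_sum_le _ _).trans (Finset.sum_le_sum fun i _ => ?_)
      rw [norm_smul, Real.norm_of_nonneg (G_nonneg _ _ _)]
      apply mul_le_mul_of_nonneg_right _ (norm_nonneg _)
      refine (G_le (i :: l) x v hv).trans ?_
      have : ‖x‖ ≤ ‖ξ‖ + 1 := by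
        have h1 := mem_ball_iff_norm.1 hx
        have h2 := norm_le_norm_add_norm_sub' x ξ
        linarith
      rw [List.length_cons]
      gcongr)
    (integrable_const _)
    (by
      refine Filter.Eventually.of_forall fun v x _ => ?_
      have h1 : HasFDerivAt (fun x : Fin N → ℝ => ∑ i, x i * v i ^ 2)
          (∑ i, v i ^ 2 • (ContinuousLinearMap.proj i : (Fin N → ℝ) →L[ℝ] ℝ)) x := by
        apply HasFDerivAt.fun_sum
        intro i _
        exact (ContinuousLinearMap.proj (R := ℝ) (φ := fun _ : Fin N => ℝ) i).hasFDerivAt.mul_const _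
      have h2 := (h1.exp).const_mul ((l.map (fun i => v i ^ 2)).prod)
      refine h2.congr_fderiv ?_
      simp only [G, Finset.smul_sum, smul_smul, List.map_cons, List.prod_cons]
      refine Finset.sum_congr rfl fun i _ => ?_
      congr 1
      ring)
  refine key.congr_fderiv ?_
  rw [integral_finsetSum _ (fun i _ => (G_int F hsphere (i :: l) ξ).smul_const _)]
  refine Finset.sum_congr rfl fun i _ => ?_
  rw [integral_smul_const]
  rfl

lemma Mo_contDiff (hsphere : ∀ᵐ v ∂F, ∑ i, (v i) ^ 2 = (N : ℝ)) (l : List (Fin N)) : ContDiff ℝ ∞ (Mo F l) := by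
  rw [contDiff_infty]
  intro n
  induction n generalizing l with
  | zero =>
    rw [Nat.cast_zero, contDiff_zero]
    exact continuous_iff_continuousAt.2 fun ξ => (Mo_deriv F hsphere l ξ).continuousAt
  | succ n ih =>
    rw [Nat.cast_succ, contDiff_succ_iff_hasFDerivAt]
    refine ⟨_, ?_, Mo_deriv F hsphere l⟩
    exact ContDiff.sum fun i _ => (ih (i :: l)).smul contDiff_const

lemma D_Mo (hsphere : ∀ᵐ v ∂F, ∑ i, (v i) ^ 2 = (N : ℝ)) (l : List (Fin N)) : D l (Mo F []) = Mo F l := by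
  induction l with
  | nil => rfl
  | cons a l ih =>
    funext x
    rw [D, ih]
    beta_reduce
    rw [(Mo_deriv F hsphere l x).fderiv]
    simp [Pi.single_apply]

lemma Mo_pos (hsphere : ∀ᵐ v ∂F, ∑ i, (v i) ^ 2 = (N : ℝ)) (ξ : Fin N → ℝ) : 0 < Mo F [] ξ := by
  have := integral_exp_pos (μ := F) (f := fun v => ∑ i, ξ i * (v i) ^ 2)
    (by
      have h := G_int F hsphere [] ξ
      unfold G at h
      simpa using h)
  simpa [Mo, G] using this

lemma prod_int (hsphere : ∀ᵐ v ∂F, ∑ i, (v i) ^ 2 = (N : ℝ)) (S : Finset (Fin N)) (k : Fin N → ℕ) :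
    Integrable (fun v => ∏ i ∈ S, (v i ^ 2) ^ k i) F := by
  refine Integrable.of_bound (by fun_prop : Continuous _).aestronglyMeasurable
    (∏ i ∈ S, (N:ℝ) ^ k i) ?_
  filter_upwards [hsphere] with v hv
  rw [Real.norm_of_nonneg (by positivity)]
  apply Finset.prod_le_prod
  · intros; positivity
  · intro i _
    exact pow_le_pow_left₀ (sq_nonneg _) (e_le v hv i) _

lemma moment_step (hsphere : ∀ᵐ v ∂F, ∑ i, (v i) ^ 2 = (N : ℝ)) (hsym : ∀ σ : Equiv.Perm (Fin N), Measure.map (fun v => v ∘ σ) F = F)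
    (S : Finset (Fin N)) (a : Fin N) (ha : a ∉ S) (k : Fin N → ℕ) (hk : k a ≠ 0) :
    (∫ v, ∏ i ∈ insert a S, (v i ^ 2) ^ k i ∂F) * ((N:ℝ) - S.card) ≤
      (N:ℝ) ^ k a * ∫ v, ∏ i ∈ S, (v i ^ 2) ^ k i ∂F := by
  have hswap : ∀ b ∉ S, ∫ v, ∏ i ∈ insert a S, (v i ^ 2) ^ k i ∂F =
      ∫ v, (v b ^ 2) ^ k a * ∏ i ∈ S, (v i ^ 2) ^ k i ∂F := by
    intro b hb
    conv_lhs => rw [← hsym (Equiv.swap a b)]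
    have hmeas : Measurable (fun v : Fin N → ℝ => v ∘ (Equiv.swap a b)) :=
      measurable_pi_lambda _ fun i => measurable_pi_apply _
    rw [integral_map hmeas.aemeasurable (by fun_prop : Continuous _).aestronglyMeasurable]
    congr 1
    funext v
    rw [Finset.prod_insert ha]
    simp only [Function.comp_apply, Equiv.swap_apply_left]
    congr 1
    refine Finset.prod_congr rfl fun i hi => ?_
    rw [Equiv.swap_apply_of_ne_of_ne]
    · rintro rfl; exact ha hi
    · rintro rfl; exact hb hi
  have hint : ∀ b, Integrable (fun v => (v b ^ 2) ^ k a * ∏ i ∈ S, (v i ^ 2) ^ k i) F := by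
    intro b
    refine (prod_int F hsphere S k).bdd_mul (c := (N:ℝ) ^ k a)
      (by fun_prop : Continuous _).aestronglyMeasurable ?_
    filter_upwards [hsphere] with v hv
    rw [Real.norm_of_nonneg (by positivity)]
    exact pow_le_pow_left₀ (sq_nonneg _) (e_le v hv b) _
  have hcard : ((Sᶜ.card : ℕ) : ℝ) = (N:ℝ) - S.card := by
    rw [Finset.card_compl, Fintype.card_fin, Nat.cast_sub]
    simpa using Finset.card_le_univ S
  rw [← hcard, mul_comm, ← nsmul_eq_mul, ← Finset.sum_const,
    Finset.sum_congr rfl (fun b hb => hswap b (Finset.mem_compl.1 hb)),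
    ← integral_finsetSum _ (fun b _ => hint b), ← integral_const_mul]
  apply integral_mono_ae (integrable_finsetSum _ fun b _ => hint b)
    ((prod_int F hsphere S k).const_mul _)
  filter_upwards [hsphere] with v hv
  rw [← Finset.sum_mul]
  apply mul_le_mul_of_nonneg_right _ (by positivity)
  calc ∑ b ∈ Sᶜ, (v b ^ 2) ^ k a ≤ ∑ b, (v b ^ 2) ^ k a :=
        Finset.sum_le_univ_sum_of_nonneg fun _ => by positivity
    _ ≤ ∑ b, v b ^ 2 * (N:ℝ) ^ (k a - 1) := by
        apply Finset.sum_le_sum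
        intro b _
        obtain ⟨j, hj⟩ := Nat.exists_eq_succ_of_ne_zero hk
        rw [hj, Nat.succ_sub_one, pow_succ']
        exact mul_le_mul_of_nonneg_left (pow_le_pow_left₀ (sq_nonneg _) (e_le v hv b) _)
          (sq_nonneg _)
    _ = (N:ℝ) ^ k a := by
        rw [← Finset.sum_mul, hv, ← pow_succ', Nat.sub_add_cancel (Nat.pos_of_ne_zero hk)]

lemma moment_bound (hsphere : ∀ᵐ v ∂F, ∑ i, (v i) ^ 2 = (N : ℝ)) (hsym : ∀ σ : Equiv.Perm (Fin N), Measure.map (fun v => v ∘ σ) F = F)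
    (k : Fin N → ℕ) (S : Finset (Fin N)) :
    (∀ i ∈ S, k i ≠ 0) → (S.card : ℝ) ≤ N / 2 + 1 →
    (∫ v, ∏ i ∈ S, (v i ^ 2) ^ k i ∂F) * (N:ℝ) ^ S.card ≤
      (N:ℝ) ^ (∑ i ∈ S, k i) * 2 ^ (S.card - 1) := by
  induction S using Finset.induction_on with
  | empty => intros; simp
  | insert a S ha ih =>
    intro hk hc
    have hstep := moment_step F hsphere hsym S a ha k (hk a (Finset.mem_insert_self _ _))
    rw [Finset.card_insert_of_notMem ha] at hc ⊢
    push_cast at hc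
    have ih' := ih (fun i hi => hk i (Finset.mem_insert_of_mem hi)) (by linarith)
    rw [Finset.sum_insert ha, Nat.add_sub_cancel]
    rcases S.eq_empty_or_nonempty with rfl | hS
    · simpa using hstep
    · obtain ⟨c, hc'⟩ := Nat.exists_eq_succ_of_ne_zero hS.card_pos.ne'
      have h0 : 0 ≤ ∫ v, ∏ i ∈ insert a S, (v i ^ 2) ^ k i ∂F :=
        integral_nonneg fun v => by positivity
      set E := ∫ v, ∏ i ∈ insert a S, (v i ^ 2) ^ k i ∂F
      set E' := ∫ v, ∏ i ∈ S, (v i ^ 2) ^ k i ∂F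
      have h1 : E * (N:ℝ) ≤ 2 * ((N:ℝ) ^ k a * E') := by
        refine le_trans ?_ (mul_le_mul_of_nonneg_left hstep zero_le_two)
        nlinarith
      calc E * (N:ℝ) ^ (S.card + 1) = E * N * (N:ℝ) ^ S.card := by ring
        _ ≤ 2 * ((N:ℝ) ^ k a * E') * (N:ℝ) ^ S.card := by gcongr
        _ = 2 * (N:ℝ) ^ k a * (E' * (N:ℝ) ^ S.card) := by ring
        _ ≤ 2 * (N:ℝ) ^ k a * ((N:ℝ) ^ (∑ i ∈ S, k i) * 2 ^ (S.card - 1)) := by gcongr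
        _ = _ := by rw [hc', Nat.succ_sub_one, pow_add, Nat.succ_eq_add_one, pow_succ (2:ℝ)]; ring

end measure

/-- The scale. -/
noncomputable def w {N : ℕ} (l : List (Fin N)) : ℝ :=
  (N:ℝ) ^ l.length * (2 / N) ^ l.toFinset.card

section fin

variable {N : ℕ} (F : Measure (Fin N → ℝ)) [IsProbabilityMeasure F]

lemma w_mul (hN : 2 ≤ N) (x y l : List (Fin N)) (h1 : x.length + y.length = l.length)
    (h2 : x.toFinset ∪ y.toFinset = l.toFinset) : w x * w y ≤ w l := by
  unfold w
  have hN' : (2:ℝ) ≤ N := by exact_mod_cast hN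
  have h3 : l.toFinset.card ≤ x.toFinset.card + y.toFinset.card := by
    rw [← h2]; exact Finset.card_union_le _ _
  have h4 : (2 / (N:ℝ)) ^ (x.toFinset.card + y.toFinset.card) ≤ (2 / (N:ℝ)) ^ l.toFinset.card :=
    pow_le_pow_of_le_one (by positivity) (by rw [div_le_one (by linarith)]; exact hN') h3
  calc _ = (N:ℝ) ^ l.length * (2 / (N:ℝ)) ^ (x.toFinset.card + y.toFinset.card) := by
        rw [← h1, pow_add, pow_add]; ring
    _ ≤ _ := by gcongr

lemma Mo_bound (hsphere : ∀ᵐ v ∂F, ∑ i, (v i) ^ 2 = (N : ℝ)) (hN : 2 ≤ N)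
    (hsym : ∀ σ : Equiv.Perm (Fin N), Measure.map (fun v => v ∘ σ) F = F) (l : List (Fin N)) (hl : l ≠ []) (hlen : (l.length : ℝ) ≤ N / 2 + 1) :
    |Mo F l 0| ≤ 1 / 2 * w l := by
  have hN' : (2:ℝ) ≤ N := by exact_mod_cast hN
  have hc : (l.toFinset.card : ℝ) ≤ N / 2 + 1 :=
    le_trans (by exact_mod_cast l.toFinset_card_le) hlen
  have h := moment_bound F hsphere hsym (fun i => l.count i) l.toFinset
    (fun i hi => by simpa [List.count_eq_zero] using hi) hc
  have h1 : Mo F l 0 = ∫ v, ∏ i ∈ l.toFinset, (v i ^ 2) ^ l.count i ∂F := by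
    unfold Mo G
    congr 1
    funext v
    rw [Finset.prod_list_map_count]
    simp
  rw [← h1, List.sum_toFinset_count_eq_length] at h
  have hnn : 0 ≤ Mo F l 0 := integral_nonneg fun v => G_nonneg _ _ _
  rw [abs_of_nonneg hnn]
  have hpos : 0 < l.toFinset.card := by
    rw [Finset.card_pos]
    simpa [List.toFinset_nonempty_iff] using hl
  obtain ⟨c, hc'⟩ := Nat.exists_eq_succ_of_ne_zero hpos.ne'
  unfold w
  rw [hc'] at h ⊢
  rw [Nat.succ_sub_one] at h
  have hNp : (0:ℝ) < N := by linarith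
  rw [div_pow, ← le_div_iff₀ (by positivity)] at *
  refine h.trans (le_of_eq ?_)
  rw [Nat.succ_eq_add_one, pow_succ (2:ℝ)]
  ring

lemma log_contDiff (hsphere : ∀ᵐ v ∂F, ∑ i, (v i) ^ 2 = (N : ℝ)) : ContDiff ℝ ∞ (fun ξ => Real.log (Mo F [] ξ)) :=
  (Mo_contDiff F hsphere []).log fun ξ => (Mo_pos F hsphere ξ).ne'

lemma recursion (hsphere : ∀ᵐ v ∂F, ∑ i, (v i) ^ 2 = (N : ℝ)) (l : List (Fin N)) (a : Fin N) :
    Mo F (l ++ [a]) 0 = ((splits l).map (fun q => Mo F q.1 0 *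
      D (q.2 ++ [a]) (fun ξ => Real.log (Mo F [] ξ)) 0)).sum := by
  have hK := log_contDiff F hsphere
  rw [← D_Mo F hsphere, D_snoc]
  have h1 : D [a] (Mo F []) = fun ξ => Mo F [] ξ * D [a] (fun ξ => Real.log (Mo F [] ξ)) ξ := by
    funext ξ
    have hd := (Mo_contDiff F hsphere []).differentiable (by simp) ξ
    simp only [D]
    rw [(hd.hasFDerivAt.log (Mo_pos F hsphere ξ).ne').fderiv]
    simp only [_root_.smul_apply, smul_eq_mul]
    field_simp [(Mo_pos F hsphere ξ).ne']
  rw [h1, D_mul l (Mo_contDiff F hsphere []) (D_contDiff [a] hK)]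
  simp only [D_Mo F hsphere, D_snoc]

lemma cum_bound (hsphere : ∀ᵐ v ∂F, ∑ i, (v i) ^ 2 = (N : ℝ)) (hN : 2 ≤ N)
    (hsym : ∀ σ : Equiv.Perm (Fin N), Measure.map (fun v => v ∘ σ) F = F) (p : ℕ) : ∀ (l : List (Fin N)) (a : Fin N), l.length = p →
    ((p:ℝ) + 1 ≤ N / 2 + 1) →
    |D (l ++ [a]) (fun ξ => Real.log (Mo F [] ξ)) 0| ≤
      1 / 2 * (2 ^ p * (p.factorial : ℝ)) * w (l ++ [a]) := by
  induction p using Nat.strong_induction_on with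
  | _ p ih =>
  intro l a hl hp
  have hrec := recursion F hsphere l a
  obtain ⟨rest, hr, hne⟩ := splits_head l
  have hmem := splits_mem l
  have hsum := splits_sum l (fun t => 2 ^ t * (t.factorial : ℝ))
  have hA := A_bound l.length
  rw [← hsum] at hA
  rw [hr] at hrec hmem hA
  simp only [List.map_cons, List.sum_cons] at hrec hA
  have hM0 : Mo F [] 0 = 1 := by simp [Mo, G]
  rw [hM0, one_mul] at hrec
  set κ := fun l : List (Fin N) => D (l ++ [a]) (fun ξ => Real.log (Mo F [] ξ)) 0 with hκ
  have hw0 : 0 ≤ w (l ++ [a]) := by unfold w; positivity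
  have hrest : |(rest.map (fun q => Mo F q.1 0 * κ q.2)).sum| ≤
      1 / 4 * w (l ++ [a]) * (rest.map (fun q => 2 ^ q.2.length * (q.2.length.factorial : ℝ))).sum := by
    have hmem' : ∀ q ∈ rest, |Mo F q.1 0 * κ q.2| ≤
        1 / 4 * w (l ++ [a]) * (2 ^ q.2.length * (q.2.length.factorial : ℝ)) := by
      intro q hq
      obtain ⟨h1, h2⟩ := hmem q (List.mem_cons_of_mem _ hq)
      have h3 : 0 < q.1.length := List.length_pos_iff.2 (hne q hq)
      have h4 : q.2.length < p := by omega
      have h4' : (q.2.length : ℝ) ≤ p := by exact_mod_cast h4.le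
      have h5 := ih _ h4 q.2 a rfl (by linarith)
      have h6' : (q.1.length : ℝ) ≤ p := by exact_mod_cast (by omega : q.1.length ≤ p)
      have h6 := Mo_bound F hsphere hN hsym q.1 (hne q hq) (by linarith)
      have h7 : w q.1 * w (q.2 ++ [a]) ≤ w (l ++ [a]) :=
        w_mul hN _ _ _ (by simp; omega) (by simp [← h2, Finset.union_assoc])
      rw [abs_mul]
      have h8 : 0 ≤ w q.1 := by unfold w; positivity
      calc _ ≤ (1 / 2 * w q.1) * (1 / 2 * (2 ^ q.2.length * (q.2.length.factorial : ℝ)) *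
              w (q.2 ++ [a])) := by
            apply mul_le_mul h6 h5 (abs_nonneg _) (by positivity)
        _ = 1 / 4 * (2 ^ q.2.length * (q.2.length.factorial : ℝ)) * (w q.1 * w (q.2 ++ [a])) := by
            ring
        _ ≤ 1 / 4 * (2 ^ q.2.length * (q.2.length.factorial : ℝ)) * w (l ++ [a]) := by gcongr
        _ = _ := by ring
    clear hrec hA hr hne hmem
    induction rest with
    | nil => simp
    | cons q L ih2 =>
      simp only [List.map_cons, List.sum_cons, mul_add]
      refine (abs_add_le _ _).trans (add_le_add (hmem' q (by simp)) ?_)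
      exact ih2 fun q hq => hmem' q (List.mem_cons_of_mem _ hq)
  have hMl := Mo_bound F hsphere hN hsym (l ++ [a]) (by simp) (by simpa [hl] using hp)
  change |κ l| ≤ _
  rw [hl] at hA
  have e1 : κ l = Mo F (l ++ [a]) 0 - (rest.map (fun q => Mo F q.1 0 * κ q.2)).sum := by
    rw [hrec]; simp [hκ]
  rw [e1]
  refine (abs_sub _ _).trans ((add_le_add hMl hrest).trans ?_)
  have hP : (1:ℝ) ≤ 2 ^ p * (p.factorial : ℝ) := by
    have : 1 ≤ 2 ^ p * p.factorial := Nat.mul_pos (by positivity) p.factorial_pos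
    exact_mod_cast this
  set R := (rest.map (fun q => 2 ^ q.2.length * (q.2.length.factorial : ℝ))).sum
  have : 1/2 + 1/4 * R ≤ 1 / 2 * (2 ^ p * (p.factorial : ℝ)) := by linarith
  calc _ = (1/2 + 1/4 * R) * w (l ++ [a]) := by ring
    _ ≤ _ := by gcongr

end fin

end SymCum

/-- For a symmetric probability measure on `S^{N-1}(√N)` and any label sequence `J` of
length `n ≤ N/2 + 1`, `|κ[e_J]| ≤ 4^{n-1} (n-1)! N^{n - len(J)}`, where `len(J)` is the
number of distinct labels in `J`. -/
theorem generic_symmetric_cumulant_bound (N : ℕ) (hN : 2 ≤ N)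
    (F : Measure (Fin N → ℝ)) [IsProbabilityMeasure F]
    (hsym : ∀ σ : Equiv.Perm (Fin N), Measure.map (fun v => v ∘ σ) F = F)
    (hsphere : ∀ᵐ v ∂F, ∑ i, (v i) ^ 2 = (N : ℝ))
    (n : ℕ) (hn1 : 1 ≤ n) (hn2 : (n : ℝ) ≤ (N : ℝ) / 2 + 1)
    (J : Fin n → Fin N) :
    |jointEnergyCumulant F J| ≤
      (4 : ℝ) ^ (n - 1) * (Nat.factorial (n - 1) : ℝ) *
        (N : ℝ) ^ (n - (Finset.univ.image J).card) := by
  have hfun : (fun ξ : Fin N → ℝ => Real.log (∫ v, Real.exp (∑ i, ξ i * (v i) ^ 2) ∂F)) =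
      fun ξ => Real.log (SymCum.Mo F [] ξ) := by
    funext ξ; simp [SymCum.Mo, SymCum.G]
  unfold jointEnergyCumulant
  rw [hfun, SymCum.D_iter (SymCum.log_contDiff F hsphere)]
  obtain ⟨p, rfl⟩ : ∃ p, n = p + 1 := ⟨n - 1, by omega⟩
  rcases List.eq_nil_or_concat (List.ofFn J) with h | ⟨l, a, h⟩
  · simp at h
  have hlen : l.length = p := by
    have := congrArg List.length h
    simp at this; omega
  have hb := SymCum.cum_bound F hsphere hN hsym p l a hlen (by push_cast at hn2; exact hn2)
  have hset : (l ++ [a]).toFinset = Finset.univ.image J := by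
    rw [← List.concat_eq_append, ← h]; ext; rw [List.mem_toFinset, List.mem_ofFn]; simp
  rw [h, List.concat_eq_append]
  refine hb.trans ?_
  have hw : SymCum.w (l ++ [a]) = (N:ℝ) ^ (p + 1) * (2 / N) ^ (Finset.univ.image J).card := by
    unfold SymCum.w; rw [hset]; simp [hlen]
  rw [hw]
  have hm : (Finset.univ.image J).card ≤ p + 1 := by
    simpa using (Finset.card_image_le (s := Finset.univ) (f := J))
  set m := (Finset.univ.image J).card
  have hNp : (0:ℝ) < N := by exact_mod_cast (by omega : 0 < N)
  have h1 : (N:ℝ) ^ (p + 1) * (2 / N) ^ m = 2 ^ m * (N:ℝ) ^ (p + 1 - m) := by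
    have : (N:ℝ) ^ (p + 1) = (N:ℝ) ^ (p + 1 - m) * (N:ℝ) ^ m := by
      rw [← pow_add, Nat.sub_add_cancel hm]
    rw [this, div_pow]; field_simp
  have h2 : (2:ℝ) ^ m ≤ 2 ^ (p + 1) := pow_le_pow_right₀ one_le_two hm
  rw [h1, Nat.add_sub_cancel]
  have h4 : (4:ℝ) ^ p = 2 ^ p * 2 ^ p := by rw [← mul_pow]; norm_num
  calc _ ≤ 1 / 2 * (2 ^ p * (p.factorial : ℝ)) * (2 ^ (p + 1) * (N:ℝ) ^ (p + 1 - m)) := by gcongr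
    _ = _ := by rw [h4, pow_succ]; ring
end

section
/- Suppose F is a symmetric probability measure on S^{N-1}(√N) and e_i := v_i². For 2 ≤ n ≤ N, the cumulant with one repeated label satisfies κ[e_1, e_1, e_2, ..., e_{n-1}] = -((N-(n-1))/(n-1)) · κ[e_1, e_2, ..., e_n]. -/
open MeasureTheory Finset

open scoped ContDiff

/-- directional derivative -/
noncomputable def dirD {E : Type*} [NormedAddCommGroup E] [NormedSpace ℝ E] (v : E) (f : E → ℝ) :
    E → ℝ := fun x => fderiv ℝ f x v

theorem dirD_contDiff {E : Type*} [NormedAddCommGroup E] [NormedSpace ℝ E] (v : E) {f : E → ℝ}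
    (hf : ContDiff ℝ ∞ f) : ContDiff ℝ ∞ (dirD v f) := by
  have h := (contDiff_infty_iff_fderiv.1 hf).2
  exact h.clm_apply contDiff_const

theorem dirD_comm {E : Type*} [NormedAddCommGroup E] [NormedSpace ℝ E] (v w : E) {f : E → ℝ}
    (hf : ContDiff ℝ ∞ f) : dirD v (dirD w f) = dirD w (dirD v f) := by
  funext x
  have h := (contDiff_infty_iff_fderiv.1 hf).2
  have hd : DifferentiableAt ℝ (fderiv ℝ f) x := (h.differentiable (by simp)) x
  have key : ∀ a b : E, dirD a (dirD b f) x = fderiv ℝ (fderiv ℝ f) x a b := by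
    intro a b
    unfold dirD
    rw [fderiv_clm_apply hd (by fun_prop)]
    simp
  rw [key, key]
  have hs : IsSymmSndFDerivAt ℝ f x :=
    hf.contDiffAt.isSymmSndFDerivAt (by
      rw [minSmoothness_of_isRCLikeNormedField]
      exact WithTop.coe_le_coe.2 le_top)
  exact hs v w

theorem foldr_dirD_contDiff {E : Type*} [NormedAddCommGroup E] [NormedSpace ℝ E] {f : E → ℝ}
    (hf : ContDiff ℝ ∞ f) (l : List E) : ContDiff ℝ ∞ (l.foldr dirD f) := by
  induction l with
  | nil => simpa
  | cons a l ih => exact dirD_contDiff a ih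

theorem foldr_dirD_perm {E : Type*} [NormedAddCommGroup E] [NormedSpace ℝ E] {f : E → ℝ}
    (hf : ContDiff ℝ ∞ f) {l l' : List E} (h : l.Perm l') :
    l.foldr dirD f = l'.foldr dirD f := by
  induction h with
  | nil => rfl
  | cons x _ ih => simp only [List.foldr_cons, ih]
  | swap x y l =>
    simp only [List.foldr_cons]
    exact dirD_comm _ _ (foldr_dirD_contDiff hf l)
  | trans _ _ ih1 ih2 => exact ih1.trans ih2

theorem iteratedFDeriv_eq_foldr {E : Type*} [NormedAddCommGroup E] [NormedSpace ℝ E] {f : E → ℝ}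
    (hf : ContDiff ℝ ∞ f) (n : ℕ) (v : Fin n → E) (x : E) :
    iteratedFDeriv ℝ n f x v = (List.ofFn v).foldr dirD f x := by
  induction n generalizing x with
  | zero => simp
  | succ n ih =>
    have hd : DifferentiableAt ℝ (iteratedFDeriv ℝ n f) x :=
      (hf.differentiable_iteratedFDeriv (by exact_mod_cast ENat.natCast_lt_top n)) x
    rw [hd.iteratedFDeriv_succ_apply_left', List.ofFn_succ, List.foldr_cons]
    simp only [ih]
    rfl

theorem iteratedFDeriv_perm {E : Type*} [NormedAddCommGroup E] [NormedSpace ℝ E] {f : E → ℝ}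
    (hf : ContDiff ℝ ∞ f) (n : ℕ) (v : Fin n → E) (x : E) (σ : Equiv.Perm (Fin n)) :
    iteratedFDeriv ℝ n f x (v ∘ σ) = iteratedFDeriv ℝ n f x v := by
  rw [iteratedFDeriv_eq_foldr hf, iteratedFDeriv_eq_foldr hf,
    foldr_dirD_perm hf (Equiv.Perm.ofFn_comp_perm σ v)]

theorem integrable_sum_smul {ι α E : Type*} [Fintype ι] [MeasurableSpace α] {μ : Measure α}
    [NormedAddCommGroup E] [NormedSpace ℝ E] (h : ι → α → ℝ) (hi : ∀ j, Integrable (h j) μ)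
    (P : ι → E) : Integrable (fun v => ∑ j, h j v • P j) μ :=
  integrable_finsetSum (f := fun j v => h j v • P j) _ fun j _ => (hi j).smul_const (P j)

theorem integral_sum_smul {ι α E : Type*} [Fintype ι] [MeasurableSpace α] {μ : Measure α}
    [NormedAddCommGroup E] [NormedSpace ℝ E] [CompleteSpace E]
    (h : ι → α → ℝ) (hi : ∀ j, Integrable (h j) μ)
    (P : ι → E) : ∑ j, (∫ v, h j v ∂μ) • P j = ∫ v, ∑ j, h j v • P j ∂μ := by
  rw [integral_finsetSum (f := fun j v => h j v • P j) _ fun j _ => (hi j).smul_const (P j)]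
  simp only [integral_smul_const]

section smooth
variable {N : ℕ} (F : Measure (Fin N → ℝ)) [IsProbabilityMeasure F]

theorem ae_sq_le (hsphere : ∀ᵐ v ∂F, ∑ i, (v i) ^ 2 = (N : ℝ)) :
    ∀ᵐ v ∂F, ∀ i, (v i) ^ 2 ≤ (N : ℝ) := by
  filter_upwards [hsphere] with v hv i
  rw [← hv]
  exact Finset.single_le_sum (f := fun i => (v i) ^ 2) (fun j _ => sq_nonneg _) (Finset.mem_univ i)

theorem ae_exp_le (hsphere : ∀ᵐ v ∂F, ∑ i, (v i) ^ 2 = (N : ℝ)) :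
    ∀ᵐ v ∂F, ∀ ξ : Fin N → ℝ,
      Real.exp (∑ i, ξ i * (v i) ^ 2) ≤ Real.exp (‖ξ‖ * N) := by
  filter_upwards [hsphere] with v hv ξ
  apply Real.exp_le_exp.2
  rw [← hv, Finset.mul_sum]
  refine Finset.sum_le_sum fun i _ => mul_le_mul_of_nonneg_right ?_ (sq_nonneg _)
  exact (le_abs_self _).trans (norm_le_pi_norm ξ i)

theorem integrable_aux (hsphere : ∀ᵐ v ∂F, ∑ i, (v i) ^ 2 = (N : ℝ))
    (g : (Fin N → ℝ) → ℝ) (hg : Measurable g) (C : ℝ) (hC : ∀ᵐ v ∂F, |g v| ≤ C)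
    (ξ : Fin N → ℝ) : Integrable (fun v => g v * Real.exp (∑ i, ξ i * (v i) ^ 2)) F := by
  refine Integrable.of_bound (C := C * Real.exp (‖ξ‖ * N))
    (by fun_prop) ?_
  filter_upwards [hC, ae_exp_le F hsphere] with v h1 h2
  rw [Real.norm_eq_abs, abs_mul, Real.abs_exp]
  exact mul_le_mul h1 (h2 ξ) (Real.exp_pos _).le ((abs_nonneg _).trans h1)

set_option maxHeartbeats 1000000 in
theorem hasFDerivAt_aux (hsphere : ∀ᵐ v ∂F, ∑ i, (v i) ^ 2 = (N : ℝ))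
    (g : (Fin N → ℝ) → ℝ) (hg : Measurable g) (C : ℝ) (hC : ∀ᵐ v ∂F, |g v| ≤ C)
    (ξ : Fin N → ℝ) :
    HasFDerivAt (fun ξ : Fin N → ℝ => ∫ v, g v * Real.exp (∑ i, ξ i * (v i) ^ 2) ∂F)
      (∑ j, (∫ v, (g v * (v j) ^ 2) * Real.exp (∑ i, ξ i * (v i) ^ 2) ∂F) •
        (ContinuousLinearMap.proj j : (Fin N → ℝ) →L[ℝ] ℝ)) ξ := by
  have hC' : ∀ j : Fin N, ∀ᵐ v ∂F, |g v * (v j) ^ 2| ≤ C * N := by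
    intro j
    filter_upwards [hC, ae_sq_le F hsphere] with v h1 h2
    rw [abs_mul, abs_of_nonneg (sq_nonneg (v j))]
    exact mul_le_mul h1 (h2 j) (sq_nonneg _) ((abs_nonneg _).trans h1)
  have hint : ∀ (j : Fin N) (ξ : Fin N → ℝ),
      Integrable (fun v => (g v * (v j) ^ 2) * Real.exp (∑ i, ξ i * (v i) ^ 2)) F :=
    fun j ξ => integrable_aux F hsphere _ (by fun_prop) _ (hC' j) ξ
  have hrw : (∑ j, (∫ v, (g v * (v j) ^ 2) * Real.exp (∑ i, ξ i * (v i) ^ 2) ∂F) •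
        (ContinuousLinearMap.proj j : (Fin N → ℝ) →L[ℝ] ℝ)) =
      ∫ v, ∑ j, ((g v * (v j) ^ 2) * Real.exp (∑ i, ξ i * (v i) ^ 2)) •
        (ContinuousLinearMap.proj j : (Fin N → ℝ) →L[ℝ] ℝ) ∂F :=
    integral_sum_smul (fun j v => (g v * (v j) ^ 2) * Real.exp (∑ i, ξ i * (v i) ^ 2))
      (fun j => hint j ξ) (fun j => (ContinuousLinearMap.proj j : (Fin N → ℝ) →L[ℝ] ℝ))
  rw [hrw]
  refine hasFDerivAt_integral_of_dominated_of_fderiv_le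
    (F := fun (ξ : Fin N → ℝ) v => g v * Real.exp (∑ i, ξ i * (v i) ^ 2))
    (F' := fun ξ v => ∑ j, ((g v * (v j) ^ 2) * Real.exp (∑ i, ξ i * (v i) ^ 2)) •
        (ContinuousLinearMap.proj j : (Fin N → ℝ) →L[ℝ] ℝ))
    (bound := fun _ => ∑ j : Fin N, (C * N * Real.exp ((‖ξ‖ + 1) * N)) *
        ‖(ContinuousLinearMap.proj j : (Fin N → ℝ) →L[ℝ] ℝ)‖)
    (Metric.ball_mem_nhds ξ one_pos) (Filter.Eventually.of_forall fun x => ?_) ?_ ?_ ?_ ?_ ?_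
  · exact (integrable_aux F hsphere g hg C hC x).aestronglyMeasurable
  · exact integrable_aux F hsphere g hg C hC ξ
  · have hI : Integrable (fun v => ∑ j, ((g v * (v j) ^ 2) *
        Real.exp (∑ i, ξ i * (v i) ^ 2)) •
        (ContinuousLinearMap.proj j : (Fin N → ℝ) →L[ℝ] ℝ)) F :=
      integrable_sum_smul (fun j v => (g v * (v j) ^ 2) * Real.exp (∑ i, ξ i * (v i) ^ 2))
        (fun j => hint j ξ) (fun j => (ContinuousLinearMap.proj j : (Fin N → ℝ) →L[ℝ] ℝ))
    exact hI.aestronglyMeasurable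
  · filter_upwards [ae_all_iff.2 hC', ae_exp_le F hsphere] with v h1 h2 x hx
    refine (norm_sum_le _ _).trans (Finset.sum_le_sum fun j _ => ?_)
    rw [norm_smul]
    refine mul_le_mul_of_nonneg_right ?_ (norm_nonneg _)
    rw [Real.norm_eq_abs, abs_mul, Real.abs_exp]
    refine mul_le_mul (h1 j) ((h2 x).trans (Real.exp_le_exp.2 ?_)) (Real.exp_pos _).le
      ((abs_nonneg _).trans (h1 j))
    refine mul_le_mul_of_nonneg_right ?_ (Nat.cast_nonneg _)
    have h3 : ‖x - ξ‖ < 1 := by simpa [dist_eq_norm] using hx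
    have h4 := norm_le_norm_add_norm_sub' x ξ
    linarith
  · exact integrable_const _
  · refine Filter.Eventually.of_forall fun v x _ => ?_
    have h0 : HasFDerivAt (fun ξ : Fin N → ℝ => ∑ i, ξ i * (v i) ^ 2)
        (∑ j, (v j) ^ 2 • (ContinuousLinearMap.proj j : (Fin N → ℝ) →L[ℝ] ℝ)) x :=
      HasFDerivAt.fun_sum fun j _ => (hasFDerivAt_apply j x).mul_const _
    refine (h0.exp.const_mul (g v)).congr_fderiv ?_
    rw [Finset.smul_sum, Finset.smul_sum]
    refine Finset.sum_congr rfl fun j _ => ?_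
    rw [smul_smul, smul_smul]
    congr 1
    ring

theorem contDiff_aux (hsphere : ∀ᵐ v ∂F, ∑ i, (v i) ^ 2 = (N : ℝ)) (n : ℕ) :
    ∀ (g : (Fin N → ℝ) → ℝ) (_ : Measurable g) (C : ℝ) (_ : ∀ᵐ v ∂F, |g v| ≤ C),
    ContDiff ℝ n (fun ξ : Fin N → ℝ => ∫ v, g v * Real.exp (∑ i, ξ i * (v i) ^ 2) ∂F) := by
  induction n with
  | zero =>
    intro g hg C hC
    rw [Nat.cast_zero, contDiff_zero]
    exact continuous_iff_continuousAt.2 fun ξ =>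
      (hasFDerivAt_aux F hsphere g hg C hC ξ).continuousAt
  | succ n ih =>
    intro g hg C hC
    push_cast
    rw [contDiff_succ_iff_hasFDerivAt]
    refine ⟨_, ?_, hasFDerivAt_aux F hsphere g hg C hC⟩
    refine ContDiff.sum fun j _ => ContDiff.fun_smul ?_ contDiff_const
    refine ih _ (by fun_prop) (C * N) ?_
    filter_upwards [hC, ae_sq_le F hsphere] with v h1 h2
    rw [abs_mul, abs_of_nonneg (sq_nonneg (v j))]
    exact mul_le_mul h1 (h2 j) (sq_nonneg _) ((abs_nonneg _).trans h1)

theorem integrable_exp (hsphere : ∀ᵐ v ∂F, ∑ i, (v i) ^ 2 = (N : ℝ)) (ξ : Fin N → ℝ) :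
    Integrable (fun v => Real.exp (∑ i, ξ i * (v i) ^ 2)) F := by
  simpa using integrable_aux F hsphere (fun _ => 1) measurable_const 1 (by simp) ξ

theorem mgf_pos' (hsphere : ∀ᵐ v ∂F, ∑ i, (v i) ^ 2 = (N : ℝ)) (ξ : Fin N → ℝ) :
    0 < ∫ v, Real.exp (∑ i, ξ i * (v i) ^ 2) ∂F :=
  integral_exp_pos (integrable_exp F hsphere ξ)

/-- the cumulant generating function -/
noncomputable def cgfE : (Fin N → ℝ) → ℝ :=
  fun ξ : Fin N → ℝ => Real.log (∫ v, Real.exp (∑ i, ξ i * (v i) ^ 2) ∂F)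

theorem cgfE_contDiff (hsphere : ∀ᵐ v ∂F, ∑ i, (v i) ^ 2 = (N : ℝ)) :
    ContDiff ℝ ∞ (cgfE F) := by
  refine ContDiff.log ?_ fun ξ => (mgf_pos' F hsphere ξ).ne'
  rw [contDiff_infty]
  intro n
  simpa using contDiff_aux F hsphere n (fun _ => 1) measurable_const 1 (by simp)

theorem cgfE_add (hsphere : ∀ᵐ v ∂F, ∑ i, (v i) ^ 2 = (N : ℝ)) (ξ : Fin N → ℝ) (t : ℝ) :
    cgfE F (ξ + t • (fun _ => 1)) = cgfE F ξ + t * N := by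
  unfold cgfE
  have h : ∫ v, Real.exp (∑ i, (ξ + t • (fun _ => (1 : ℝ)) : Fin N → ℝ) i * (v i) ^ 2) ∂F =
      (∫ v, Real.exp (∑ i, ξ i * (v i) ^ 2) ∂F) * Real.exp (t * N) := by
    rw [← integral_mul_const]
    refine integral_congr_ae ?_
    filter_upwards [hsphere] with v hv
    rw [← Real.exp_add, ← hv, Finset.mul_sum, ← Finset.sum_add_distrib]
    congr 1
    refine Finset.sum_congr rfl fun i _ => ?_
    simp
    ring
  rw [h, Real.log_mul (mgf_pos' F hsphere ξ).ne' (Real.exp_pos _).ne', Real.log_exp]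

theorem cgfE_perm (hsym : ∀ σ : Equiv.Perm (Fin N), Measure.map (fun v => v ∘ σ) F = F)
    (σ : Equiv.Perm (Fin N)) (ξ : Fin N → ℝ) : cgfE F (ξ ∘ σ) = cgfE F ξ := by
  unfold cgfE
  congr 1
  conv_rhs => rw [← hsym σ.symm]
  have hm : Measurable (fun v : Fin N → ℝ => v ∘ σ.symm) :=
    measurable_pi_lambda _ fun i => measurable_pi_apply _
  rw [integral_map hm.aemeasurable
    (Measurable.aestronglyMeasurable (by fun_prop))]
  refine integral_congr_ae (Filter.Eventually.of_forall fun v => ?_)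
  simp only [Function.comp]
  rw [← Equiv.sum_comp σ (fun i => ξ i * (v (σ.symm i)) ^ 2)]
  simp

theorem K_eq {n : ℕ} (J : Fin n → Fin N) : jointEnergyCumulant F J =
    iteratedFDeriv ℝ n (cgfE F) 0 (fun k => Pi.single (J k) 1) := rfl

theorem K_perm_arg (hsphere : ∀ᵐ v ∂F, ∑ i, (v i) ^ 2 = (N : ℝ)) {n : ℕ} (J : Fin n → Fin N)
    (τ : Equiv.Perm (Fin n)) : jointEnergyCumulant F (J ∘ τ) = jointEnergyCumulant F J := by
  rw [K_eq, K_eq]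
  exact iteratedFDeriv_perm (cgfE_contDiff F hsphere) n (fun k => Pi.single (J k) 1) 0 τ

theorem K_perm_label (hsym : ∀ σ : Equiv.Perm (Fin N), Measure.map (fun v => v ∘ σ) F = F)
    (hsphere : ∀ᵐ v ∂F, ∑ i, (v i) ^ 2 = (N : ℝ)) {n : ℕ} (J : Fin n → Fin N)
    (σ : Equiv.Perm (Fin N)) : jointEnergyCumulant F (σ ∘ J) = jointEnergyCumulant F J := by
  rw [K_eq, K_eq]
  let L : (Fin N → ℝ) →L[ℝ] (Fin N → ℝ) :=
    ContinuousLinearMap.pi fun i => ContinuousLinearMap.proj (σ i)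
  have hL : cgfE F ∘ L = cgfE F := by
    funext ξ
    exact cgfE_perm F hsym σ ξ
  have h := L.iteratedFDeriv_comp_right (cgfE_contDiff F hsphere) 0 (i := n)
    (by exact_mod_cast le_top)
  rw [hL, map_zero] at h
  conv_lhs => rw [h]
  rw [ContinuousMultilinearMap.compContinuousLinearMap_apply]
  congr 1
  funext k i
  simp [L, Pi.single_apply]

theorem K_sum (hsphere : ∀ᵐ v ∂F, ∑ i, (v i) ^ 2 = (N : ℝ)) {m : ℕ} (hm : m ≠ 0)
    (w : Fin m → Fin N) :
    ∑ i, jointEnergyCumulant F (Fin.cons i w : Fin (m + 1) → Fin N) = 0 := by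
  have hsm := cgfE_contDiff F hsphere
  have hd : DifferentiableAt ℝ (iteratedFDeriv ℝ m (cgfE F)) 0 :=
    (hsm.differentiable_iteratedFDeriv (by exact_mod_cast ENat.natCast_lt_top m)) 0
  have hconst : ∀ t : ℝ, iteratedFDeriv ℝ m (cgfE F) (0 + t • (fun _ => 1)) =
      iteratedFDeriv ℝ m (cgfE F) 0 := by
    intro t
    rw [← iteratedFDeriv_comp_add_right]
    simp only [cgfE_add F hsphere]
    have h2 := iteratedFDeriv_add_apply (𝕜 := ℝ) (i := m) (x := (0 : Fin N → ℝ)) (f := cgfE F)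
      (g := fun _ => t * N) (hsm.contDiffAt.of_le (by exact_mod_cast le_top)) contDiffAt_const
    rw [iteratedFDeriv_const_of_ne hm] at h2
    rw [Pi.zero_apply, add_zero] at h2
    exact h2
  have h1 : fderiv ℝ (iteratedFDeriv ℝ m (cgfE F)) 0 (fun _ => 1) = 0 := by
    rw [← hd.lineDeriv_eq_fderiv, lineDeriv]
    simp only [hconst]
    simp
  have h2 : ∀ i, jointEnergyCumulant F (Fin.cons i w : Fin (m + 1) → Fin N) =
      fderiv ℝ (iteratedFDeriv ℝ m (cgfE F)) 0 (Pi.single i 1)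
        (fun k => Pi.single (w k) 1) := fun i => by
    rw [K_eq, iteratedFDeriv_succ_apply_left]
    rfl
  simp only [h2]
  rw [← _root_.sum_apply, ← map_sum, Finset.univ_sum_single, h1]
  rfl

end smooth

/-- For a symmetric probability measure on `S^{N-1}(√N)` and `2 ≤ n ≤ N`, one has
`κ[e_1,e_1,e_2,…,e_{n-1}] = -((N-(n-1))/(n-1)) κ[e_1,…,e_n]`: here `J` is an injective
(non-repeated) label sequence and `J'` repeats the first label once. -/
theorem one_repetition_cumulant_identity (N : ℕ) (hN : 2 ≤ N)
    (F : Measure (Fin N → ℝ)) [IsProbabilityMeasure F]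
    (hsym : ∀ σ : Equiv.Perm (Fin N), Measure.map (fun v => v ∘ σ) F = F)
    (hsphere : ∀ᵐ v ∂F, ∑ i, (v i) ^ 2 = (N : ℝ))
    (n : ℕ) (hn2 : 2 ≤ n) (hnN : n ≤ N)
    (J : Fin n → Fin N) (hJ : Function.Injective J)
    (J' : Fin n → Fin N)
    (hJ' : ∀ k : Fin n,
      J' k = J ⟨(k : ℕ) - 1, lt_of_le_of_lt (Nat.sub_le (k : ℕ) 1) k.isLt⟩) :
    jointEnergyCumulant F J' =
      -(((N : ℝ) - ((n : ℝ) - 1)) / ((n : ℝ) - 1)) * jointEnergyCumulant F J := by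
  obtain ⟨m, rfl⟩ : ∃ m, n = m + 2 := ⟨n - 2, by omega⟩
  set w : Fin (m + 1) → Fin N := fun k => J k.castSucc with hw
  have hwi : Function.Injective w := hJ.comp (Fin.castSucc_injective _)
  have hJ'w : J' = (Fin.cons (w 0) w : Fin (m + 2) → Fin N) := by
    funext k
    refine Fin.cases ?_ (fun j => ?_) k
    · rw [hJ']; rfl
    · rw [hJ']; rfl
  have hJw : J = (Fin.cons (J (Fin.last _)) w : Fin (m + 2) → Fin N) ∘ finRotate (m + 2) := by
    have := Fin.snoc_eq_cons_rotate w (J (Fin.last _))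
    rw [Function.comp_def, ← this]
    exact (Fin.snoc_init_self J).symm
  have hlast : ∀ k, w k ≠ J (Fin.last _) := fun k h =>
    (Fin.castSucc_lt_last k).ne (hJ h)
  have hA : ∀ k, jointEnergyCumulant F (Fin.cons (w k) w : Fin (m + 2) → Fin N) =
      jointEnergyCumulant F J' := by
    intro k
    rw [hJ'w, ← K_perm_label F hsym hsphere _ (Equiv.swap (w k) (w 0)),
      ← K_perm_arg F hsphere (Fin.cons (w 0) w) (Equiv.swap k.succ (Fin.succ 0))]
    congr 1
    funext j
    refine Fin.cases ?_ (fun j => ?_) j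
    · have : Equiv.swap k.succ (Fin.succ 0) (0 : Fin (m + 2)) = 0 :=
        Equiv.swap_apply_of_ne_of_ne (Fin.succ_ne_zero _).symm (Fin.succ_ne_zero _).symm
      simp only [Function.comp, this, Fin.cons_zero, Equiv.swap_apply_left]
    · have : Equiv.swap k.succ (Fin.succ 0) j.succ = (Equiv.swap k 0 j).succ :=
        (Fin.succ_injective _).swap_apply k 0 j
      simp only [Function.comp, this, Fin.cons_succ]
      exact hwi.swap_apply k 0 j
  have hB : ∀ i, i ∉ Finset.univ.image w →
      jointEnergyCumulant F (Fin.cons i w : Fin (m + 2) → Fin N) = jointEnergyCumulant F J := by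
    intro i hi
    have hi' : ∀ k, w k ≠ i := fun k h => hi (by simp [← h])
    conv_rhs => rw [hJw]
    rw [K_perm_arg F hsphere, ← K_perm_label F hsym hsphere _ (Equiv.swap i (J (Fin.last _)))]
    congr 1
    funext j
    refine Fin.cases ?_ (fun j => ?_) j
    · simp
    · simp only [Function.comp, Fin.cons_succ]
      exact Equiv.swap_apply_of_ne_of_ne (hi' j) (hlast j)
  have hsum := K_sum F hsphere (Nat.succ_ne_zero m) w
  rw [← Finset.sum_add_sum_compl (Finset.univ.image w),
    Finset.sum_image (fun a _ b _ h => hwi h), Finset.sum_congr rfl (fun k _ => hA k),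
    Finset.sum_congr rfl (fun i hi => hB i (Finset.mem_compl.1 hi))] at hsum
  have hcard : (Finset.univ.image w).card = m + 1 := by
    rw [Finset.card_image_of_injective _ hwi]; simp
  simp only [Finset.sum_const, Finset.card_compl, hcard, Finset.card_univ, Fintype.card_fin,
    nsmul_eq_mul] at hsum
  rw [Nat.cast_sub (by omega)] at hsum
  push_cast at hsum ⊢
  have hpos : (m : ℝ) + 2 - 1 ≠ 0 := by
    have : (0 : ℝ) ≤ m := Nat.cast_nonneg m
    linarith
  field_simp
  linarith
end
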